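/- arXiv:1602.02976 — 3 statements merged into one kernel-verified Lean document; each statement's English description precedes it below -/
import Mathlib

section
/- Let n ≥ 3 and let f = Σ_α a_α x^α ∈ ℂ[x₁,…,xₙ] be a polynomial with f(0) = 0 which is convenient, non-degenerate at 0, and non-degenerate; assume moreover that f has no linear term (the coefficient of each xᵢ in f is zero), and that, with m := deg f, the degree-m homogeneous part of f equals x₁^m + ⋯ + xₙ^m. Let g ∈ ℂ[x₀,x₁,…,xₙ] be the homogenization g := Σ_α a_α x₀^{m−|α|} x₁^{α₁}⋯xₙ^{αₙ}. Then the set of points x ∈ ℂ^{n+1} ∖ {0} satisfying g(x) = 0 and ∂g/∂x₀(x) = ∂g/∂x₁(x) = ⋯ = ∂g/∂xₙ(x) = 0 is exactly {(c,0,…,0) : c ∈ ℂ ∖ {0}}; that is, the projective hypersurface X = {g = 0} ⊆ ℙⁿ(ℂ) has exactly one singular point, namely [1:0:⋯:0]. -/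
open MvPolynomial

noncomputable section

/-- The exponent vector of a monomial, regarded as a point of `ℝⁿ`. -/
def expR {n : ℕ} (α : Fin n →₀ ℕ) : Fin n → ℝ := fun i => (α i : ℝ)

/-- The convex hull of the union, over `α ∈ s`, of the translates `α + ℝ₊ⁿ` of the
nonnegative orthant. -/
def newtonRegion {n : ℕ} (s : Set (Fin n →₀ ℕ)) : Set (Fin n → ℝ) :=
  convexHull ℝ {x | ∃ α ∈ s, ∃ r : Fin n → ℝ, (∀ i, 0 ≤ r i) ∧ x = expR α + r}

/-- The Newton polyhedron `Γ₊(f)` of `f` at the origin. -/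
def NewtonPolyhedron {n : ℕ} (f : MvPolynomial (Fin n) ℂ) : Set (Fin n → ℝ) :=
  newtonRegion {α | α ∈ f.support}

/-- The union of all bounded (nonempty, exposed) faces of `A`. -/
def boundedFacesUnion {n : ℕ} (A : Set (Fin n → ℝ)) : Set (Fin n → ℝ) :=
  {x | ∃ F : Set (Fin n → ℝ), F.Nonempty ∧ IsExposed ℝ A F ∧
    Bornology.IsBounded F ∧ x ∈ F}

/-- The Newton boundary `Γ_f` of `f`: the union of the bounded faces of `Γ₊(f)`. -/
def NewtonBoundary {n : ℕ} (f : MvPolynomial (Fin n) ℂ) : Set (Fin n → ℝ) :=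
  boundedFacesUnion (NewtonPolyhedron f)

/-- `f` is convenient: `Γ₊(f)` meets the positive part of every coordinate axis. -/
def Convenient {n : ℕ} (f : MvPolynomial (Fin n) ℂ) : Prop :=
  ∀ i : Fin n, ∃ t : ℝ, 0 < t ∧ Pi.single i t ∈ NewtonPolyhedron f

open Classical in
/-- The part `f_F` of `f` supported on a subset `F ⊆ ℝⁿ`. -/
def faceRestrict {n : ℕ} (f : MvPolynomial (Fin n) ℂ) (F : Set (Fin n → ℝ)) :
    MvPolynomial (Fin n) ℂ :=
  ∑ α ∈ f.support.filter (fun α => expR α ∈ F), monomial α (f.coeff α)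

/-- The system `g = ∂g/∂x₁ = ⋯ = ∂g/∂xₙ = 0` has a solution in `(ℂ ∖ {0})ⁿ`. -/
def hasTorusSolution {n : ℕ} (g : MvPolynomial (Fin n) ℂ) : Prop :=
  ∃ x : Fin n → ℂ, (∀ i, x i ≠ 0) ∧ eval x g = 0 ∧ ∀ i, eval x (pderiv i g) = 0

/-- `f` is non-degenerate at `0`: for every bounded face `F` of `Γ₊(f)` the system
`f_F = ∂f_F/∂x₁ = ⋯ = ∂f_F/∂xₙ = 0` has no solution in the torus. -/
def NondegAtZero {n : ℕ} (f : MvPolynomial (Fin n) ℂ) : Prop :=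
  ∀ F : Set (Fin n → ℝ), F.Nonempty → IsExposed ℝ (NewtonPolyhedron f) F →
    Bornology.IsBounded F → ¬ hasTorusSolution (faceRestrict f F)

/-- `x` is a singular point of the hypersurface `{h = 0} ⊆ ℂⁿ`. -/
def IsSingularPt {n : ℕ} (h : MvPolynomial (Fin n) ℂ) (x : Fin n → ℂ) : Prop :=
  eval x h = 0 ∧ ∀ i, eval x (pderiv i h) = 0

/-- The Newton polytope `NP(f)`: the convex hull of `supp(f)` in `ℝⁿ`. -/
def NewtonPolytope {n : ℕ} (f : MvPolynomial (Fin n) ℂ) : Set (Fin n → ℝ) :=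
  convexHull ℝ (expR '' {α | α ∈ f.support})

/-- `f` is non-degenerate: for every (nonempty, exposed) face `F` of `NP(f)`
(including `NP(f)` itself) the system `f_F = ∂f_F/∂x₁ = ⋯ = ∂f_F/∂xₙ = 0` has no
solution in the torus `(ℂ ∖ {0})ⁿ`. -/
def Nondegenerate {n : ℕ} (f : MvPolynomial (Fin n) ℂ) : Prop :=
  ∀ F : Set (Fin n → ℝ), F.Nonempty → IsExposed ℝ (NewtonPolytope f) F →
    ¬ hasTorusSolution (faceRestrict f F)

/-- The homogenization `g = Σ_α a_α x₀^{m-|α|} x₁^{α₁} ⋯ xₙ^{αₙ}` of `f`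
with respect to the degree `m`, a polynomial in the `n + 1` variables
`x₀, x₁, …, xₙ`. -/
def homogenize {n : ℕ} (f : MvPolynomial (Fin n) ℂ) (m : ℕ) :
    MvPolynomial (Fin (n + 1)) ℂ :=
  ∑ α ∈ f.support,
    monomial (Finsupp.single 0 (m - ∑ i, α i) + Finsupp.mapDomain Fin.succ α)
      (f.coeff α)

theorem eval_homogenize_monomial {n : ℕ} (m : ℕ) (α : Fin n →₀ ℕ) (a : ℂ)
    (x : Fin (n + 1) → ℂ) :
    eval x (monomial (Finsupp.single 0 (m - ∑ i, α i) + Finsupp.mapDomain Fin.succ α) a) =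
      a * (x 0 ^ (m - ∑ i, α i) * ∏ i, x (Fin.succ i) ^ α i) := by
  rw [eval_monomial, Finsupp.prod_fintype _ _ (fun i => pow_zero _), Fin.prod_univ_succ]
  simp [Finsupp.mapDomain_apply (Fin.succ_injective n), Finsupp.mapDomain_of_notMem_range]

theorem eval_homogenize {n : ℕ} (f : MvPolynomial (Fin n) ℂ) (m : ℕ) (x : Fin (n + 1) → ℂ) :
    eval x (homogenize f m) =
      ∑ α ∈ f.support, f.coeff α * (x 0 ^ (m - ∑ i, α i) * ∏ i, x (Fin.succ i) ^ α i) := by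
  simp only [homogenize, map_sum, eval_homogenize_monomial]

/-- The Euler operator `xᵢ ∂/∂xᵢ` multiplies each term of the homogenization by its exponent. -/
theorem eval_mul_pderiv_homogenize {n : ℕ} (f : MvPolynomial (Fin n) ℂ) (m : ℕ)
    (x : Fin (n + 1) → ℂ) (j : Fin n) :
    x (Fin.succ j) * eval x (pderiv (Fin.succ j) (homogenize f m)) =
      ∑ α ∈ f.support,
        f.coeff α * α j * (x 0 ^ (m - ∑ i, α i) * ∏ i, x (Fin.succ i) ^ α i) := by
  have h : x (Fin.succ j) * eval x (pderiv (Fin.succ j) (homogenize f m)) =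
      eval x (X (Fin.succ j) * pderiv (Fin.succ j) (homogenize f m)) := by simp
  rw [h, homogenize, map_sum, Finset.mul_sum, map_sum]
  refine Finset.sum_congr rfl fun α _ => ?_
  rw [X_mul_pderiv_monomial, map_nsmul, eval_homogenize_monomial]
  simp [Finsupp.mapDomain_apply (Fin.succ_injective n)]
  ring

theorem eval_faceRestrict {n : ℕ} (f : MvPolynomial (Fin n) ℂ) (F : Set (Fin n → ℝ))
    [DecidablePred fun α : Fin n →₀ ℕ => expR α ∈ F] (x : Fin n → ℂ) :
    eval x (faceRestrict f F) =
      ∑ α ∈ f.support, if expR α ∈ F then f.coeff α * ∏ i, x i ^ α i else 0 := by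
  rw [← Finset.sum_filter, faceRestrict, map_sum]
  refine Finset.sum_congr (by congr) fun α _ => ?_
  rw [eval_monomial, Finsupp.prod_fintype _ _ (fun i => pow_zero _)]

theorem eval_mul_pderiv_faceRestrict {n : ℕ} (f : MvPolynomial (Fin n) ℂ)
    (F : Set (Fin n → ℝ)) [DecidablePred fun α : Fin n →₀ ℕ => expR α ∈ F]
    (x : Fin n → ℂ) (j : Fin n) :
    x j * eval x (pderiv j (faceRestrict f F)) =
      ∑ α ∈ f.support, if expR α ∈ F then f.coeff α * α j * ∏ i, x i ^ α i else 0 := by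
  have h : x j * eval x (pderiv j (faceRestrict f F)) =
      eval x (X j * pderiv j (faceRestrict f F)) := by simp
  rw [h, ← Finset.sum_filter, faceRestrict, map_sum, Finset.mul_sum, map_sum]
  refine Finset.sum_congr (by congr) fun α _ => ?_
  rw [X_mul_pderiv_monomial, map_nsmul, eval_monomial,
    Finsupp.prod_fintype _ _ (fun i => pow_zero _), nsmul_eq_mul]
  ring

/-- The points of the Newton polytope whose coordinates in `s` vanish form an exposed set. -/
theorem isExposed_newtonPolytope_coord {n : ℕ} (f : MvPolynomial (Fin n) ℂ)
    (s : Set (Fin n)) :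
    IsExposed ℝ (NewtonPolytope f) {v ∈ NewtonPolytope f | ∀ i ∈ s, v i = 0} := by
  classical
  have hnonneg : ∀ v ∈ NewtonPolytope f, ∀ i, 0 ≤ v i := by
    intro v hv
    refine convexHull_min (t := {v : Fin n → ℝ | ∀ i, 0 ≤ v i}) ?_ ?_ hv
    · rintro _ ⟨α, -, rfl⟩ i
      exact Nat.cast_nonneg _
    · intro u hu v hv a b ha hb _ i
      exact add_nonneg (mul_nonneg ha (hu i)) (mul_nonneg hb (hv i))
  rintro ⟨u, hu, hu0⟩
  let l : (Fin n → ℝ) →L[ℝ] ℝ :=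
    -∑ i ∈ Finset.univ.filter (· ∈ s), ContinuousLinearMap.proj (R := ℝ) (φ := fun _ => ℝ) i
  have hl : ∀ v, l v = -∑ i ∈ Finset.univ.filter (· ∈ s), v i := by
    intro v
    simp [l]
  refine ⟨l, Set.ext fun v => ⟨?_, ?_⟩⟩
  · rintro ⟨hv, hv0⟩
    refine ⟨hv, fun w hw => ?_⟩
    have h0 : ∑ i ∈ Finset.univ.filter (· ∈ s), v i = 0 :=
      Finset.sum_eq_zero fun i hi => hv0 i (Finset.mem_filter.1 hi).2
    rw [hl, hl, h0, neg_le_neg_iff]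
    exact Finset.sum_nonneg fun i _ => hnonneg w hw i
  · rintro ⟨hv, hmax⟩
    refine ⟨hv, fun i hi => ?_⟩
    have h0 : ∑ i ∈ Finset.univ.filter (· ∈ s), u i = 0 :=
      Finset.sum_eq_zero fun i hi => hu0 i (Finset.mem_filter.1 hi).2
    have h1 := hmax u hu
    rw [hl, hl, h0, neg_le_neg_iff] at h1
    have h2 := le_antisymm h1 (Finset.sum_nonneg fun i _ => hnonneg v hv i)
    exact (Finset.sum_eq_zero_iff_of_nonneg fun i _ => hnonneg v hv i).1 h2 i (by simpa using hi)

theorem expR_mem_newtonPolytope {n : ℕ} {f : MvPolynomial (Fin n) ℂ} {α : Fin n →₀ ℕ}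
    (hα : α ∈ f.support) : expR α ∈ NewtonPolytope f :=
  subset_convexHull ℝ _ ⟨α, hα, rfl⟩

/-- A non-degenerate polynomial whose support meets each coordinate axis has no affine
singular point other than the origin. -/
theorem Nondegenerate.eq_zero_of_euler {n : ℕ} {f : MvPolynomial (Fin n) ℂ}
    (hnd : Nondegenerate f) (haxis : ∀ i, ∃ k, Finsupp.single i k ∈ f.support) (z : Fin n → ℂ)
    (hz : ∑ α ∈ f.support, f.coeff α * ∏ i, z i ^ α i = 0)
    (hz' : ∀ j, ∑ α ∈ f.support, f.coeff α * α j * ∏ i, z i ^ α i = 0) : z = 0 := by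
  classical
  by_contra hne
  obtain ⟨k, hk⟩ := Function.ne_iff.1 hne
  set F : Set (Fin n → ℝ) := {v ∈ NewtonPolytope f | ∀ i ∈ {i | z i = 0}, v i = 0} with hF
  let w : Fin n → ℂ := fun i => if z i = 0 then 1 else z i
  have hw : ∀ i, w i ≠ 0 := by
    intro i
    by_cases h : z i = 0 <;> simp [w, h]
  have key : ∀ c : (Fin n →₀ ℕ) → ℂ,
      (∑ α ∈ f.support, if expR α ∈ F then c α * ∏ i, w i ^ α i else 0) =
        ∑ α ∈ f.support, c α * ∏ i, z i ^ α i := by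
    intro c
    refine Finset.sum_congr rfl fun α hα => ?_
    split_ifs with h
    · congr 1
      refine Finset.prod_congr rfl fun i _ => ?_
      by_cases hi : z i = 0
      · have : α i = 0 := Nat.cast_eq_zero.1 (h.2 i hi)
        simp [this]
      · simp [w, hi]
    · have : ∃ i, z i = 0 ∧ α i ≠ 0 := by
        by_contra! hcon
        exact h ⟨expR_mem_newtonPolytope hα, fun i hi => by simp [expR, hcon i hi]⟩
      obtain ⟨i, hi, hαi⟩ := this
      rw [Finset.prod_eq_zero (Finset.mem_univ i) (by simp [hi, hαi]), mul_zero]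
  refine hnd F ?_ (isExposed_newtonPolytope_coord f _) ⟨w, hw, ?_, fun j => ?_⟩
  · obtain ⟨d, hd⟩ := haxis k
    refine ⟨_, expR_mem_newtonPolytope hd, fun i hi => ?_⟩
    have hki : k ≠ i := by
      rintro rfl
      exact hk hi
    simp [expR, hki]
  · rw [eval_faceRestrict, key, hz]
  · refine (mul_eq_zero.1 ?_).resolve_left (hw j)
    rw [eval_mul_pderiv_faceRestrict, key fun α => f.coeff α * α j, hz']

theorem pow_sub_mul_prod_pow {n : ℕ} {m : ℕ} {c : ℂ} (hc : c ≠ 0) (y : Fin n → ℂ)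
    (α : Fin n →₀ ℕ) (hα : ∑ i, α i ≤ m) :
    c ^ (m - ∑ i, α i) * ∏ i, y i ^ α i = c ^ m * ∏ i, (y i / c) ^ α i := by
  simp only [div_pow, Finset.prod_div_distrib, Finset.prod_pow_eq_pow_sum]
  rw [pow_sub₀ _ hc hα]
  field_simp

/-- At a point of the hyperplane at infinity, the Euler operator applied to the homogenization
only sees the top-degree part. -/
theorem eval_mul_pderiv_homogenize_of_zero {n : ℕ} (f : MvPolynomial (Fin n) ℂ)
    (x : Fin (n + 1) → ℂ) (hx : x 0 = 0) (j : Fin n) :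
    x (Fin.succ j) * eval x (pderiv (Fin.succ j) (homogenize f f.totalDegree)) =
      eval (fun i => x (Fin.succ i))
        (X j * pderiv j (homogeneousComponent f.totalDegree f)) := by
  rw [eval_mul_pderiv_homogenize, homogeneousComponent_apply, map_sum, Finset.mul_sum, map_sum,
    Finset.sum_filter]
  refine Finset.sum_congr rfl fun α hα => ?_
  have hle : ∑ i, α i ≤ f.totalDegree := by
    have := le_totalDegree hα
    rwa [Finsupp.sum_fintype _ _ (fun _ => rfl)] at this
  have hdeg : α.degree = ∑ i, α i := Finsupp.degree_eq_sum α
  split_ifs with h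
  · rw [X_mul_pderiv_monomial, map_nsmul, eval_monomial,
      Finsupp.prod_fintype _ _ (fun i => pow_zero _), ← h, hdeg, Nat.sub_self, nsmul_eq_mul]
    ring
  · have : f.totalDegree - ∑ i, α i ≠ 0 := by omega
    simp [hx, this]

/-- A polynomial without terms of degree at most one has a homogenization that is singular at
the points representing the origin. -/
theorem homogenize_singular_of_forall_eq_zero {n : ℕ} (f : MvPolynomial (Fin n) ℂ) (m : ℕ)
    (h0 : f.coeff 0 = 0) (hlin : ∀ i : Fin n, f.coeff (Finsupp.single i 1) = 0)
    (x : Fin (n + 1) → ℂ) (hx : ∀ i, i ≠ 0 → x i = 0) :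
    eval x (homogenize f m) = 0 ∧ ∀ i, eval x (pderiv i (homogenize f m)) = 0 := by
  constructor
  · rw [eval_homogenize]
    refine Finset.sum_eq_zero fun α hα => ?_
    have hα0 : α ≠ 0 := by
      rintro rfl
      exact mem_support_iff.1 hα h0
    obtain ⟨j, hj⟩ := Finsupp.ne_iff.1 hα0
    rw [Finset.prod_eq_zero (Finset.mem_univ j), mul_zero, mul_zero]
    rw [hx _ (Fin.succ_ne_zero j), zero_pow hj]
  · intro i
    rw [homogenize, map_sum, map_sum]
    refine Finset.sum_eq_zero fun α hα => ?_
    have hα0 : ∃ j, α j - Finsupp.single i 1 (Fin.succ j) ≠ 0 := by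
      by_contra! hcon
      refine mem_support_iff.1 hα ?_
      rcases Fin.eq_zero_or_eq_succ i with rfl | ⟨k, rfl⟩
      · have : α = 0 := by
          ext j
          simpa [Finsupp.single_apply] using hcon j
        rw [this, h0]
      · have hle : ∀ j, j ≠ k → α j = 0 := by
          intro j hj
          simpa [Finsupp.single_apply, Ne.symm hj] using hcon j
        have hk : α k ≤ 1 := by
          have := hcon k
          simp at this
          omega
        have hα' : α = Finsupp.single k (α k) := by
          ext j
          by_cases hj : j = k
          · simp [hj]
          · simp [hle j hj, Ne.symm hj]
        rw [hα']
        interval_cases α k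
        · simpa using h0
        · exact hlin k
    obtain ⟨j, hj⟩ := hα0
    rw [pderiv_monomial, eval_monomial, Finsupp.prod_fintype _ _ (fun i => pow_zero _),
      Finset.prod_eq_zero (Finset.mem_univ (Fin.succ j)), mul_zero]
    rw [hx _ (Fin.succ_ne_zero j), zero_pow]
    simpa [Finsupp.mapDomain_apply (Fin.succ_injective n)] using hj

/-- Under the hypotheses of Lemma 5.1 (`mainlem`) the projectivization
`X = {g = 0} ⊆ ℙⁿ(ℂ)` of `V = {f = 0}` has exactly one singular point, namely
`[1 : 0 : ⋯ : 0]`: the zeros of `g` in `ℂ^{n+1} ∖ {0}` at which every partial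
derivative of `g` vanishes are exactly the points `(c, 0, …, 0)` with `c ≠ 0`. -/
theorem stmt8 (n : ℕ) (hn : 3 ≤ n) (f : MvPolynomial (Fin n) ℂ)
    (hf0 : eval (0 : Fin n → ℂ) f = 0)
    (hconv : Convenient f) (hnd0 : NondegAtZero f) (hnd : Nondegenerate f)
    (hlin : ∀ i : Fin n, f.coeff (Finsupp.single i 1) = 0)
    (hhom : homogeneousComponent f.totalDegree f = ∑ i : Fin n, X i ^ f.totalDegree) :
    {x : Fin (n + 1) → ℂ | x ≠ 0 ∧ eval x (homogenize f f.totalDegree) = 0 ∧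
        ∀ i, eval x (pderiv i (homogenize f f.totalDegree)) = 0} =
      {x : Fin (n + 1) → ℂ | x 0 ≠ 0 ∧ ∀ i, i ≠ 0 → x i = 0} := by
  have hc0 : f.coeff 0 = 0 := by
    rwa [← constantCoeff_eq, ← eval_zero]
  have hm : f.totalDegree ≠ 0 := by
    intro hm
    rw [hm, homogeneousComponent_zero, hc0] at hhom
    have h := congrArg (eval (0 : Fin n → ℂ)) hhom
    have h' : (n : ℂ) = 0 := by simpa using h.symm
    rw [Nat.cast_eq_zero] at h'
    omega
  have haxis : ∀ i, ∃ k, Finsupp.single i k ∈ f.support := by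
    intro i
    refine ⟨f.totalDegree, ?_⟩
    have h := congrArg (coeff (Finsupp.single i f.totalDegree)) hhom
    rw [coeff_homogeneousComponent, if_pos (by simp), coeff_sum] at h
    rw [mem_support_iff, h]
    simp [coeff_X_pow, Finsupp.single_left_inj hm]
  ext x
  constructor
  · rintro ⟨hx, hgx, hdx⟩
    rcases eq_or_ne (x 0) 0 with h0 | h0
    · refine absurd (_root_.funext fun i => ?_) hx
      rcases Fin.eq_zero_or_eq_succ i with rfl | ⟨j, rfl⟩
      · exact h0
      · have h := eval_mul_pderiv_homogenize_of_zero f x h0 j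
        rw [hdx, mul_zero, hhom, map_sum, Finset.sum_eq_single j] at h
        · have h' : x j.succ = 0 ∨ x j.succ = 0 ∧ ¬f.totalDegree - 1 = 0 := by
            simpa [hm] using h
          exact h'.elim id And.left
        · intro i _ hij
          simp [pderiv_X_of_ne hij]
        · simp
    · refine ⟨h0, fun i hi => ?_⟩
      have hle : ∀ α ∈ f.support, ∑ i, α i ≤ f.totalDegree := by
        intro α hα
        have := le_totalDegree hα
        rwa [Finsupp.sum_fintype _ _ (fun _ => rfl)] at this
      have key : ∀ c : (Fin n →₀ ℕ) → ℂ,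
          ∑ α ∈ f.support, c α *
            (x 0 ^ (f.totalDegree - ∑ i, α i) * ∏ i, x (Fin.succ i) ^ α i) = 0 →
          ∑ α ∈ f.support, c α * ∏ i, (x (Fin.succ i) / x 0) ^ α i = 0 := by
        intro c hc
        refine (mul_eq_zero.1 ?_).resolve_left (pow_ne_zero f.totalDegree h0)
        rw [Finset.mul_sum, ← hc]
        refine Finset.sum_congr rfl fun α hα => ?_
        rw [pow_sub_mul_prod_pow h0 (fun i => x (Fin.succ i)) α (hle α hα)]
        ring
      have hz := hnd.eq_zero_of_euler haxis (fun i => x (Fin.succ i) / x 0)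
        (key _ (by rw [← eval_homogenize, hgx]))
        (fun j => key (fun α => f.coeff α * α j)
          (by rw [← eval_mul_pderiv_homogenize, hdx, mul_zero]))
      obtain ⟨j, rfl⟩ := Fin.exists_succ_eq.2 hi
      simpa [h0] using congrFun hz j
  · rintro ⟨h0, hx⟩
    refine ⟨fun h => h0 (congrFun h 0), ?_⟩
    exact homogenize_singular_of_forall_eq_zero f _ hc0 hlin x hx
end
end

section
/- Let n ≥ 3 and let f = Σ_α a_α x^α ∈ ℂ[x₁,…,xₙ] be a polynomial with f(0) = 0 which is convenient, non-degenerate at 0, and non-degenerate; assume moreover that f has no linear term and that, with m := deg f, the degree-m homogeneous part of f equals x₁^m + ⋯ + xₙ^m. Let g ∈ ℂ[x₀,…,xₙ] be the homogenization g := Σ_α a_α x₀^{m−|α|} x₁^{α₁}⋯xₙ^{αₙ}. Then there exists ε₀ > 0 such that for every real ε with 0 < ε < ε₀, the homogeneous polynomial g − ε x₀^m has no point x ∈ ℂ^{n+1} ∖ {0} at which all its first partial derivatives ∂(g − ε x₀^m)/∂xᵢ (i = 0,…,n) vanish; that is, the projective hypersurface X_ε = {g − ε x₀^m = 0} ⊆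 ℙⁿ(ℂ) is smooth. -/
open MvPolynomial

noncomputable section

section Finiteness

variable {σ K : Type*} [Field K]

/-- A quotient of a polynomial ring in finitely many variables in which every `X i ^ d` is
congruent to a polynomial of degree `< d` is finite-dimensional. -/
theorem MvPolynomial.finite_quotient_of_X_pow_sub_mem [Finite σ]
    (I : Ideal (MvPolynomial σ K)) (d : ℕ) (r : σ → MvPolynomial σ K)
    (hr : ∀ i, (r i).totalDegree < d) (hI : ∀ i, X i ^ d - r i ∈ I) :
    Module.Finite K (MvPolynomial σ K ⧸ I) := by
  classical
  cases nonempty_fintype σ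
  set N := Fintype.card σ * d
  set S : Submodule K (MvPolynomial σ K) := restrictTotalDegree σ K N ⊔ I.restrictScalars K
  have key : ∀ (k : ℕ) (p : MvPolynomial σ K), p.totalDegree ≤ k → p ∈ S := by
    intro k
    induction k with
    | zero =>
      intro p hp
      exact Submodule.mem_sup_left ((mem_restrictTotalDegree _ _ _).2 (hp.trans (Nat.zero_le _)))
    | succ k ih =>
      intro p hp
      rw [p.as_sum]
      refine S.sum_mem fun α hα => ?_
      have hαk : α.degree ≤ k + 1 := (le_totalDegree hα).trans hp
      by_cases hN : α.degree ≤ N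
      · refine Submodule.mem_sup_left ((mem_restrictTotalDegree _ _ _).2 ?_)
        exact (totalDegree_monomial_le _ _).trans hN
      obtain ⟨i, hi⟩ : ∃ i, d ≤ α i := by
        by_contra! h
        refine hN ?_
        rw [Finsupp.degree_eq_sum]
        calc ∑ i, α i ≤ ∑ _i : σ, d := Finset.sum_le_sum fun i _ => (h i).le
          _ = N := by simp [N]
      have hle : Finsupp.single i d ≤ α := Finsupp.single_le_iff.2 hi
      set β := α - Finsupp.single i d
      have hα' : β + Finsupp.single i d = α := tsub_add_cancel_of_le hle
      have hdeg : β.degree + d = α.degree := by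
        rw [← hα', map_add, Finsupp.degree_single]
      have hsplit : monomial α (coeff α p) =
          monomial β (coeff α p) * r i + monomial β (coeff α p) * (X i ^ d - r i) := by
        rw [← mul_add, add_sub_cancel, X_pow_eq_monomial, monomial_mul, hα', mul_one]
      rw [hsplit]
      refine S.add_mem (ih _ ?_) (Submodule.mem_sup_right (I.mul_mem_left _ (hI i)))
      have h1 := totalDegree_mul (monomial β (coeff α p)) (r i)
      have h2 : (monomial β (coeff α p)).totalDegree ≤ β.degree := totalDegree_monomial_le _ _
      have h3 := hr i
      omega
  refine Module.Finite.of_surjective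
    ((Ideal.Quotient.mkₐ K I).toLinearMap ∘ₗ (restrictTotalDegree σ K N).subtype) fun y => ?_
  obtain ⟨p, rfl⟩ := Ideal.Quotient.mk_surjective y
  obtain ⟨q, hq, s, hs, rfl⟩ := Submodule.mem_sup.1 (key _ p le_rfl)
  refine ⟨⟨q, hq⟩, ?_⟩
  simpa [map_add] using Ideal.Quotient.eq_zero_iff_mem.2 hs

/-- The values of a polynomial `f` on the zero locus of an ideal of finite codimension are
roots of a single nonzero polynomial. -/
theorem MvPolynomial.finite_image_eval_of_finite_quotient (I : Ideal (MvPolynomial σ K))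
    [Module.Finite K (MvPolynomial σ K ⧸ I)] (f : MvPolynomial σ K) :
    {c : K | ∃ x : σ → K, (∀ p ∈ I, eval x p = 0) ∧ eval x f = c}.Finite := by
  obtain ⟨P, hP, hPf⟩ := Algebra.IsIntegral.isIntegral (R := K) (Ideal.Quotient.mkₐ K I f)
  refine (P.rootSet_finite K).subset ?_
  rintro c ⟨x, hx, rfl⟩
  rw [Polynomial.mem_rootSet_of_ne hP.ne_zero]
  rw [← Polynomial.aeval_def, Polynomial.aeval_algHom_apply] at hPf
  have := hx _ (Ideal.Quotient.eq_zero_iff_mem.1 hPf)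
  rw [← coe_aeval_eq_eval, RingHom.coe_coe] at this ⊢
  rw [Polynomial.aeval_algHom_apply, this]

theorem MvPolynomial.totalDegree_pderiv_lt {p : MvPolynomial σ K} {d : ℕ} (i : σ) (hd : 0 < d)
    (hp : p.totalDegree ≤ d) : (pderiv i p).totalDegree < d := by
  rw [totalDegree, Finset.sup_lt_iff (by simpa using hd)]
  intro β hβ
  rw [mem_support_iff, coeff_pderiv] at hβ
  have := le_totalDegree (mem_support_iff.2 (left_ne_zero_of_mul hβ))
  change (β + Finsupp.single i 1).degree ≤ _ at this
  rw [map_add, Finsupp.degree_single] at this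
  change β.degree < d
  omega

theorem MvPolynomial.IsHomogeneous.eval_smul_pow [Fintype σ] {p : MvPolynomial σ K} {d : ℕ}
    (hp : p.IsHomogeneous d) (c : K) (x : σ → K) : eval (c • x) p = c ^ d * eval x p := by
  rw [eval_eq', eval_eq', Finset.mul_sum]
  refine Finset.sum_congr rfl fun α hα => ?_
  have hdeg : ∑ i, α i = d := by
    rw [← Finsupp.degree_eq_sum, ← hp (mem_support_iff.1 hα), Finsupp.degree_eq_weight_one]
    rfl
  simp only [Pi.smul_apply, smul_eq_mul, mul_pow]
  rw [Finset.prod_mul_distrib, Finset.prod_pow_eq_pow_sum, hdeg]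
  ring

end Finiteness

section CriticalValues

variable {n : ℕ}

/-- A polynomial of degree `m ≥ 2` with leading form `x₁^m + ⋯ + xₙ^m` has finitely many
critical values. -/
theorem finite_criticalValues_of_homogeneousComponent_eq (f : MvPolynomial (Fin n) ℂ)
    (hm : 2 ≤ f.totalDegree)
    (hhom : homogeneousComponent f.totalDegree f = ∑ i : Fin n, X i ^ f.totalDegree) :
    {c : ℂ | ∃ x : Fin n → ℂ, (∀ i, eval x (pderiv i f) = 0) ∧ eval x f = c}.Finite := by
  obtain ⟨d, hd⟩ : ∃ d, f.totalDegree = d + 1 := ⟨f.totalDegree - 1, by omega⟩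
  set I := Ideal.span (Set.range fun i => pderiv i f)
  set q := ∑ k ∈ Finset.range (d + 1), homogeneousComponent k f
  have hf : f = q + ∑ i : Fin n, X i ^ (d + 1) := by
    rw [hd] at hhom
    conv_lhs => rw [← sum_homogeneousComponent f, hd, Finset.sum_range_succ, hhom]
  have hq : q.totalDegree ≤ d := totalDegree_finsetSum_le fun k hk =>
    ((homogeneousComponent_isHomogeneous k f).totalDegree_le).trans
      (Nat.lt_succ_iff.1 (Finset.mem_range.1 hk))
  have hd0 : ((d + 1 : ℕ) : ℂ) ≠ 0 := Nat.cast_ne_zero.2 d.succ_ne_zero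
  have hpd (i : Fin n) : pderiv i f = pderiv i q + C ((d + 1 : ℕ) : ℂ) * X i ^ d := by
    conv_lhs => rw [hf]
    simp [pderiv_X, Pi.single_apply, mul_comm]
  have : Module.Finite ℂ (MvPolynomial (Fin n) ℂ ⧸ I) := by
    refine finite_quotient_of_X_pow_sub_mem I d
      (fun i => C (-((d + 1 : ℕ) : ℂ)⁻¹) * pderiv i q) (fun i => ?_) fun i => ?_
    · refine lt_of_le_of_lt (totalDegree_mul _ _) ?_
      rw [totalDegree_C, zero_add]
      exact totalDegree_pderiv_lt i (by omega) hq
    · have : X i ^ d - C (-((d + 1 : ℕ) : ℂ)⁻¹) * pderiv i q =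
          C ((d + 1 : ℕ) : ℂ)⁻¹ * pderiv i f := by
        rw [hpd, mul_add, ← mul_assoc, ← C_mul, inv_mul_cancel₀ hd0, C_1, C_neg]
        ring
      rw [this]
      exact I.mul_mem_left _ (Ideal.subset_span ⟨i, rfl⟩)
  refine (finite_image_eval_of_finite_quotient I f).subset ?_
  rintro c ⟨x, hx, rfl⟩
  refine ⟨x, fun p hp => ?_, rfl⟩
  have hI : I ≤ RingHom.ker (eval x) := Ideal.span_le.2 (by rintro _ ⟨i, rfl⟩; exact hx i)
  exact hI hp

end CriticalValues

section Homogenization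

variable {n : ℕ}

theorem isHomogeneous_homogenize (f : MvPolynomial (Fin n) ℂ) {m : ℕ} (hm : f.totalDegree ≤ m) :
    (homogenize f m).IsHomogeneous m := by
  refine IsHomogeneous.sum _ _ _ fun α hα => isHomogeneous_monomial _ ?_
  have hα' : α.degree ≤ m := (le_totalDegree hα).trans hm
  rw [map_add, Finsupp.degree_single, Finsupp.degree_mapDomain, ← Finsupp.degree_eq_sum]
  omega

/-- Substitution of the constant `c` for the variable `x₀`. -/
def specializeZero (c : ℂ) : MvPolynomial (Fin (n + 1)) ℂ →ₐ[ℂ] MvPolynomial (Fin n) ℂ :=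
  aeval (Fin.cons (C c) X)

theorem specializeZero_X_zero (c : ℂ) : specializeZero (n := n) c (X 0) = C c := by
  simp [specializeZero]

theorem eval_specializeZero (c : ℂ) (y : Fin n → ℂ) (p : MvPolynomial (Fin (n + 1)) ℂ) :
    eval y (specializeZero c p) = eval (Fin.cons c y : Fin (n + 1) → ℂ) p := by
  induction p using MvPolynomial.induction_on with
  | C a => simp [specializeZero]
  | add p q hp hq => simp [hp, hq]
  | mul_X p i hp =>
    rw [map_mul, map_mul, map_mul, hp]
    refine Fin.cases ?_ (fun j => ?_) i <;> simp [specializeZero]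

theorem specializeZero_pderiv_succ (c : ℂ) (i : Fin n) (p : MvPolynomial (Fin (n + 1)) ℂ) :
    specializeZero c (pderiv i.succ p) = pderiv i (specializeZero c p) := by
  induction p using MvPolynomial.induction_on with
  | C a => simp [specializeZero]
  | add p q hp hq => simp [hp, hq]
  | mul_X p j hp =>
    have hX : specializeZero c (pderiv i.succ (X j)) = pderiv i (specializeZero c (X j)) := by
      refine Fin.cases ?_ (fun k => ?_) j
      · simp [specializeZero, pderiv_X]
      · by_cases h : k = i <;> simp [specializeZero, pderiv_X, h]
    rw [pderiv_mul, map_add, map_mul, map_mul, map_mul, pderiv_mul, hp, hX]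

theorem specializeZero_homogenize (c : ℂ) (f : MvPolynomial (Fin n) ℂ) (m : ℕ) :
    specializeZero c (homogenize f m) =
      ∑ α ∈ f.support, C (c ^ (m - ∑ i, α i)) * monomial α (f.coeff α) := by
  rw [homogenize, map_sum]
  refine Finset.sum_congr rfl fun α _ => ?_
  have h : rename Fin.succ (monomial α (f.coeff α)) =
      monomial (Finsupp.mapDomain Fin.succ α) (f.coeff α) := rename_monomial _ _ _
  have hX : (specializeZero (n := n) c).comp (rename Fin.succ) = AlgHom.id ℂ _ := by
    ext i : 1
    simp [specializeZero]
  rw [← one_mul (f.coeff α), ← monomial_mul, ← h, map_mul, ← X_pow_eq_monomial, map_pow,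
    specializeZero_X_zero, C_pow, one_mul]
  congr 1
  exact DFunLike.congr_fun hX _

theorem specializeZero_one_homogenize (f : MvPolynomial (Fin n) ℂ) (m : ℕ) :
    specializeZero 1 (homogenize f m) = f := by
  rw [specializeZero_homogenize]
  simp

theorem specializeZero_zero_homogenize (f : MvPolynomial (Fin n) ℂ) :
    specializeZero 0 (homogenize f f.totalDegree) = homogeneousComponent f.totalDegree f := by
  rw [specializeZero_homogenize, homogeneousComponent_apply, Finset.sum_filter]
  refine Finset.sum_congr rfl fun α hα => ?_
  have hα' : α.degree ≤ f.totalDegree := le_totalDegree hα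
  rw [← Finsupp.degree_eq_sum]
  split_ifs with h
  · simp [h]
  · rw [zero_pow (by omega), C_0, zero_mul]

end Homogenization

/-- Under the hypotheses of Lemma 5.1 (`mainlem`), for all sufficiently small
`ε > 0` the projective hypersurface `X_ε = {g − ε x₀^m = 0} ⊆ ℙⁿ(ℂ)` is smooth:
the polynomial `g − ε x₀^m` has no nonzero critical point in `ℂ^{n+1}`. -/
theorem stmt9 (n : ℕ) (hn : 3 ≤ n) (f : MvPolynomial (Fin n) ℂ)
    (hf0 : eval (0 : Fin n → ℂ) f = 0)
    (hconv : Convenient f) (hnd0 : NondegAtZero f) (hnd : Nondegenerate f)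
    (hlin : ∀ i : Fin n, f.coeff (Finsupp.single i 1) = 0)
    (hhom : homogeneousComponent f.totalDegree f = ∑ i : Fin n, X i ^ f.totalDegree) :
    ∃ ε₀ : ℝ, 0 < ε₀ ∧ ∀ ε : ℝ, 0 < ε → ε < ε₀ →
      ¬ ∃ x : Fin (n + 1) → ℂ, x ≠ 0 ∧
        ∀ i, eval x (pderiv i
          (homogenize f f.totalDegree - C (ε : ℂ) * X 0 ^ f.totalDegree)) = 0 := by
  set m := f.totalDegree with hm
  have hn0 : (0 : ℕ) < n := by omega
  have hm2 : 2 ≤ m := by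
    have hcoeff : coeff (Finsupp.single ⟨0, hn0⟩ m) (homogeneousComponent m f) ≠ 0 := by
      rw [hhom, coeff_sum]
      rcases Nat.eq_zero_or_pos m with h0 | h0
      · simp [h0, hn0.ne']
      · rw [Finset.sum_eq_single ⟨0, hn0⟩]
        · simp [coeff_X_pow]
        · intro j _ hj
          rw [coeff_X_pow, if_neg]
          rw [Finsupp.single_left_inj h0.ne']
          exact hj
        · simp
    rw [coeff_homogeneousComponent, Finsupp.degree_single, if_pos rfl] at hcoeff
    by_contra! hlt
    interval_cases m
    · rw [Finsupp.single_zero] at hcoeff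
      rw [eval_zero, constantCoeff_eq] at hf0
      exact hcoeff hf0
    · exact hcoeff (hlin _)
  have hfin := finite_criticalValues_of_homogeneousComponent_eq f hm2 hhom
  obtain ⟨ε₀, hε₀, hball⟩ := Metric.isOpen_iff.1
    (hfin.sdiff (t := {0})).isClosed.isOpen_compl 0 fun h => h.2 rfl
  refine ⟨ε₀, hε₀, fun ε hε hlt => ?_⟩
  rintro ⟨x, hx0, hx⟩
  set h := homogenize f m - C (ε : ℂ) * X 0 ^ m
  have hh : h.IsHomogeneous m := (isHomogeneous_homogenize f hm.ge).sub
    (by simpa using (isHomogeneous_C (Fin (n + 1)) (ε : ℂ)).mul (isHomogeneous_X_pow 0 m))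
  by_cases hx00 : x 0 = 0
  · refine hx0 (funext (Fin.cases hx00 fun i => ?_))
    have hspec : specializeZero 0 h = ∑ i : Fin n, X i ^ m := by
      rw [map_sub, specializeZero_zero_homogenize, hhom, map_mul, map_pow, specializeZero_X_zero,
        C_0, zero_pow (by omega), mul_zero, sub_zero]
    have hi := hx i.succ
    rw [← Fin.cons_self_tail x, hx00, ← eval_specializeZero, specializeZero_pderiv_succ,
      hspec] at hi
    have : (m : ℂ) * Fin.tail x i ^ (m - 1) = 0 := by
      simpa [pderiv_X, Pi.single_apply] using hi
    exact eq_zero_of_pow_eq_zero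
      ((mul_eq_zero.1 this).resolve_left (Nat.cast_ne_zero.2 (by omega)))
  · set y : Fin n → ℂ := fun i => (x 0)⁻¹ * x i.succ
    have hxy : x = x 0 • (Fin.cons 1 y : Fin (n + 1) → ℂ) := by
      funext i
      refine Fin.cases ?_ (fun j => ?_) i <;> simp [y, hx00]
    have hy (i : Fin (n + 1)) : eval (Fin.cons 1 y : Fin (n + 1) → ℂ) (pderiv i h) = 0 := by
      have hi := hx i
      rw [hxy, hh.pderiv.eval_smul_pow] at hi
      simpa [hx00] using hi
    have hspec : specializeZero 1 h = f - C (ε : ℂ) := by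
      rw [map_sub, specializeZero_one_homogenize, map_mul, map_pow, specializeZero_X_zero]
      simp [specializeZero]
    have hcrit (i : Fin n) : eval y (pderiv i f) = 0 := by
      have hi := hy i.succ
      rwa [← eval_specializeZero, specializeZero_pderiv_succ, hspec, map_sub, pderiv_C,
        sub_zero] at hi
    have hval : eval y f = ε := by
      have he := congrArg (eval (Fin.cons 1 y : Fin (n + 1) → ℂ)) hh.sum_X_mul_pderiv
      rw [map_sum, Finset.sum_eq_zero fun i _ => by rw [map_mul, hy, mul_zero], nsmul_eq_mul,
        map_mul, map_natCast, ← eval_specializeZero, hspec, map_sub, eval_C] at he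
      exact sub_eq_zero.1
        ((mul_eq_zero.1 he.symm).resolve_left (Nat.cast_ne_zero.2 (by omega)))
    refine hball (a := (ε : ℂ)) (by simpa [abs_of_pos hε] using hlt) ⟨⟨y, hcrit, hval⟩, ?_⟩
    simpa using hε.ne'
end
end

section
/- Let n ≥ 2 and let f = Σ_α a_α x^α ∈ ℂ[x₁,…,xₙ] be a non-constant polynomial with f(0) = 0 which is convenient and non-degenerate at 0, and assume the Newton polyhedron Γ₊(f) is flat, i.e. the affine span of the Newton boundary Γ_f is an affine hyperplane in ℝⁿ. Define f′ := Σ_{α ∈ Γ_f ∩ ℤⁿ} a_α x^α. Then: (1) f′ is quasi-homogeneous, i.e. there exist C ∈ ℤ_{>0} and v = (v₁,…,vₙ) ∈ (ℤ_{>0})ⁿ such that v·α = C for every α ∈ supp(f′); (2) Γ₊(f′) = Γ₊(f), and in particular Γ_{f′} = Γ_f and f′ is convenient; and (3) f′ is non-degenerate at 0. -/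
open MvPolynomial

noncomputable section

theorem expR_single {n : ℕ} (i : Fin n) (k : ℕ) :
    expR (Finsupp.single i k) = Pi.single i (k : ℝ) := by
  ext j
  by_cases h : j = i
  · subst h; simp [expR]
  · simp [expR, h]

theorem expR_mem_newtonPolyhedron {n : ℕ} {f : MvPolynomial (Fin n) ℂ} {α : Fin n →₀ ℕ}
    (hα : α ∈ f.support) : expR α ∈ NewtonPolyhedron f :=
  subset_convexHull ℝ _ ⟨α, hα, 0, fun _ => le_rfl, by simp⟩

theorem newtonRegion_mono {n : ℕ} {s t : Set (Fin n →₀ ℕ)} (h : s ⊆ t) :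
    newtonRegion s ⊆ newtonRegion t :=
  convexHull_mono fun _ ⟨α, hα, r, hr, hx⟩ => ⟨α, h hα, r, hr, hx⟩

/-- A nonnegative weight is bounded below on the Newton polyhedron by any lower bound
on the support. -/
theorem le_weight_of_mem_newtonPolyhedron {n : ℕ} {f : MvPolynomial (Fin n) ℂ}
    {u : Fin n → ℝ} (hu : ∀ i, 0 ≤ u i) {m : ℝ}
    (hm : ∀ α ∈ f.support, m ≤ ∑ i, u i * (α i : ℝ))
    {x : Fin n → ℝ} (hx : x ∈ NewtonPolyhedron f) : m ≤ ∑ i, u i * x i := by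
  have hlin : IsLinearMap ℝ fun y : Fin n → ℝ => ∑ i, u i * y i :=
    ⟨fun y z => by simp [mul_add, Finset.sum_add_distrib],
      fun c y => by simp [Finset.mul_sum, mul_left_comm]⟩
  refine convexHull_min (t := {y : Fin n → ℝ | m ≤ ∑ i, u i * y i}) ?_
    (convex_halfSpace_ge hlin m) hx
  rintro _ ⟨α, hα, r, hr, rfl⟩
  have h1 : 0 ≤ ∑ i, u i * r i := Finset.sum_nonneg fun i _ => mul_nonneg (hu i) (hr i)
  have h2 := hm α hα
  simp only [Set.mem_ofPred_eq, Pi.add_apply, mul_add, Finset.sum_add_distrib, expR]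
  linarith

theorem nonneg_of_mem_newtonPolyhedron {n : ℕ} {f : MvPolynomial (Fin n) ℂ}
    {x : Fin n → ℝ} (hx : x ∈ NewtonPolyhedron f) (i : Fin n) : 0 ≤ x i := by
  have h := le_weight_of_mem_newtonPolyhedron (f := f) (u := Pi.single i 1) (m := 0)
    (fun j => by by_cases h : j = i <;> simp [h])
    (fun α _ => by simp [Pi.single_apply]) hx
  simpa [Pi.single_apply] using h

/-- Points of the Newton polyhedron minimizing a positive weight lie on the Newton boundary. -/
theorem mem_newtonBoundary_of_minimizes {n : ℕ} {f : MvPolynomial (Fin n) ℂ}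
    {u : Fin n → ℝ} (hu : ∀ i, 0 < u i) {x : Fin n → ℝ} (hx : x ∈ NewtonPolyhedron f)
    (hmin : ∀ y ∈ NewtonPolyhedron f, ∑ i, u i * x i ≤ ∑ i, u i * y i) :
    x ∈ NewtonBoundary f := by
  let l : StrongDual ℝ (Fin n → ℝ) :=
    -∑ i, u i • (ContinuousLinearMap.proj i : (Fin n → ℝ) →L[ℝ] ℝ)
  have hl : ∀ y, l y = -∑ i, u i * y i := fun y => by simp [l]
  have hxF : x ∈ {z ∈ NewtonPolyhedron f | ∀ y ∈ NewtonPolyhedron f, l y ≤ l z} :=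
    ⟨hx, fun y hy => by rw [hl, hl]; exact neg_le_neg (hmin y hy)⟩
  refine ⟨_, ⟨x, hxF⟩, fun _ => ⟨l, rfl⟩, ?_, hxF⟩
  refine (Metric.isBounded_Icc (0 : Fin n → ℝ)
    (fun i => (∑ j, u j * x j) / u i)).subset ?_
  rintro z ⟨hz, hzmin⟩
  have h0 := fun i => nonneg_of_mem_newtonPolyhedron hz i
  refine ⟨h0, fun i => ?_⟩
  have h1 := hzmin x hx
  rw [hl, hl] at h1
  have h2 : u i * z i ≤ ∑ j, u j * z j :=
    Finset.single_le_sum (f := fun j => u j * z j)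
      (fun j _ => mul_nonneg (hu j).le (h0 j)) (Finset.mem_univ i)
  rw [le_div_iff₀ (hu i)]
  linarith

theorem finsupp_eq_single_or_exists_ne {n : ℕ} (i : Fin n) (α : Fin n →₀ ℕ) :
    α = Finsupp.single i (α i) ∨ ∃ j, j ≠ i ∧ 1 ≤ α j := by
  by_cases h : ∃ j, j ≠ i ∧ 1 ≤ α j
  · exact Or.inr h
  · push Not at h
    refine Or.inl (Finsupp.ext fun j => ?_)
    by_cases hj : j = i
    · subst hj; simp
    · have := h j hj
      rw [Finsupp.single_eq_of_ne hj]
      omega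

/-- The support of a convenient polynomial contains a pure power of every variable. -/
theorem Convenient.exists_single_mem_support {n : ℕ} {f : MvPolynomial (Fin n) ℂ}
    (hconv : Convenient f) (i : Fin n) : ∃ k, Finsupp.single i k ∈ f.support := by
  by_contra hcon
  push Not at hcon
  obtain ⟨t, -, ht⟩ := hconv i
  have hu : ∀ j, (0 : ℝ) ≤ if j = i then 0 else 1 := fun j => by split_ifs <;> norm_num
  have h := le_weight_of_mem_newtonPolyhedron (m := 1) hu ?_ ht
  · have h0 : ∑ j, (if j = i then (0 : ℝ) else 1) * (Pi.single i t : Fin n → ℝ) j = 0 :=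
      Finset.sum_eq_zero fun j _ => by by_cases hj : j = i <;> simp [hj]
    linarith
  · intro α hα
    rcases finsupp_eq_single_or_exists_ne i α with h | ⟨j, hj, hαj⟩
    · exact absurd (h ▸ hα) (hcon _)
    · have h1 : (1 : ℝ) ≤ α j := by exact_mod_cast hαj
      have h2 := Finset.single_le_sum (f := fun j => (if j = i then (0 : ℝ) else 1) * (α j : ℝ))
        (fun j _ => mul_nonneg (hu j) (Nat.cast_nonneg _)) (Finset.mem_univ j)
      simp only [hj, if_false, one_mul] at h2
      exact h1.trans h2

/-- The lowest pure power of a variable occurring in `f` lies on the Newton boundary. -/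
theorem expR_single_mem_newtonBoundary {n : ℕ} {f : MvPolynomial (Fin n) ℂ} {i : Fin n}
    {m : ℕ} (hm0 : 0 < m) (hm : Finsupp.single i m ∈ f.support)
    (hmin : ∀ k, Finsupp.single i k ∈ f.support → m ≤ k) :
    expR (Finsupp.single i m) ∈ NewtonBoundary f := by
  have hm0' : (0 : ℝ) < m := by exact_mod_cast hm0
  have hu : ∀ j, (0 : ℝ) < if j = i then 1 else (m : ℝ) := fun j => by
    split_ifs
    · exact one_pos
    · exact hm0'
  refine mem_newtonBoundary_of_minimizes hu (expR_mem_newtonPolyhedron hm) fun y hy => ?_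
  have hval : ∑ j, (if j = i then 1 else (m : ℝ)) * expR (Finsupp.single i m) j = m := by
    rw [expR_single, Finset.sum_eq_single i] <;> simp +contextual
  rw [hval]
  refine le_weight_of_mem_newtonPolyhedron (fun j => (hu j).le) (fun α hα => ?_) hy
  have hle := fun j => Finset.single_le_sum
    (f := fun j => (if j = i then 1 else (m : ℝ)) * (α j : ℝ))
    (fun j _ => mul_nonneg (hu j).le (Nat.cast_nonneg _)) (Finset.mem_univ j)
  rcases finsupp_eq_single_or_exists_ne i α with h | ⟨j, hj, hαj⟩
  · have h1 : (m : ℝ) ≤ α i := by exact_mod_cast hmin _ (h ▸ hα)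
    have h2 := hle i
    simp only [if_true, one_mul] at h2
    exact h1.trans h2
  · have h1 : (1 : ℝ) ≤ α j := by exact_mod_cast hαj
    have h2 := hle j
    simp only [hj, if_false] at h2
    nlinarith

/-- If the support contains `m i` times the `i`-th unit vector for every `i`, the Newton
polyhedron contains the part of the orthant above the simplex spanned by these points. -/
theorem mem_newtonPolyhedron_of_one_le {n : ℕ} {g : MvPolynomial (Fin n) ℂ} {m : Fin n → ℕ}
    (hm0 : ∀ i, 0 < m i) (hm : ∀ i, Finsupp.single i (m i) ∈ g.support) {x : Fin n → ℝ}
    (hx : ∀ i, 0 ≤ x i) (h1 : 1 ≤ ∑ i, (m i : ℝ)⁻¹ * x i) : x ∈ NewtonPolyhedron g := by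
  have hm0' : ∀ i, (0 : ℝ) < m i := fun i => by exact_mod_cast hm0 i
  set s := ∑ i, (m i : ℝ)⁻¹ * x i with hs
  have hs0 : 0 < s := one_pos.trans_le h1
  have hmem : ∀ i, (Pi.single i (s * m i) : Fin n → ℝ) ∈ NewtonPolyhedron g := fun i => by
    refine subset_convexHull ℝ _ ⟨_, hm i, Pi.single i ((s - 1) * m i), fun j => ?_, ?_⟩
    · rw [Pi.single_apply]
      split_ifs
      · exact mul_nonneg (by linarith) (hm0' i).le
      · exact le_rfl
    · rw [expR_single, ← Pi.single_add]
      congr 1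
      ring
  have hsum : x = ∑ i, ((m i : ℝ)⁻¹ * x i / s) • (Pi.single i (s * m i) : Fin n → ℝ) := by
    ext j
    have := (hm0' j).ne'
    rw [Finset.sum_apply, Finset.sum_eq_single j]
    · simp only [Pi.smul_apply, Pi.single_eq_same, smul_eq_mul]
      field_simp
    · intro i _ hij
      simp [Pi.single_eq_of_ne hij.symm]
    · simp
  rw [hsum]
  refine (convex_convexHull ℝ _).sum_mem (fun i _ => ?_) ?_ fun i _ => hmem i
  · exact div_nonneg (mul_nonneg (inv_nonneg.2 (hm0' i).le) (hx i)) hs0.le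
  · rw [← Finset.sum_div, ← hs, div_self hs0.ne']

theorem coeff_faceRestrict {n : ℕ} (f : MvPolynomial (Fin n) ℂ) (F : Set (Fin n → ℝ))
    [DecidablePred (· ∈ F)] (α : Fin n →₀ ℕ) :
    (faceRestrict f F).coeff α = if expR α ∈ F then f.coeff α else 0 := by
  classical
  simp only [faceRestrict, coeff_sum, coeff_monomial, Finset.sum_ite_eq', Finset.mem_filter,
    mem_support_iff]
  by_cases h1 : expR α ∈ F <;> by_cases h2 : f.coeff α = 0 <;> simp [h1, h2]

theorem mem_support_faceRestrict {n : ℕ} {f : MvPolynomial (Fin n) ℂ} {F : Set (Fin n → ℝ)}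
    {α : Fin n →₀ ℕ} : α ∈ (faceRestrict f F).support ↔ α ∈ f.support ∧ expR α ∈ F := by
  classical
  rw [mem_support_iff, coeff_faceRestrict, mem_support_iff]
  by_cases h : expR α ∈ F <;> simp [h]

theorem faceRestrict_faceRestrict_of_subset {n : ℕ} (f : MvPolynomial (Fin n) ℂ)
    {F G : Set (Fin n → ℝ)} (h : F ⊆ G) :
    faceRestrict (faceRestrict f G) F = faceRestrict f F := by
  classical
  ext α
  simp only [coeff_faceRestrict]
  by_cases hF : expR α ∈ F
  · simp [hF, h hF]
  · simp [hF]

/-- If the Newton boundary lies in the simplex hyperplane with positive weights `w`, the whole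
Newton polyhedron lies above that hyperplane. -/
theorem one_le_weight_of_newtonBoundary {n : ℕ} {f : MvPolynomial (Fin n) ℂ}
    {w : Fin n → ℝ} (hw : ∀ i, 0 < w i)
    (hb : ∀ x ∈ NewtonBoundary f, ∑ i, w i * x i = 1)
    {x : Fin n → ℝ} (hx : x ∈ NewtonPolyhedron f) : 1 ≤ ∑ i, w i * x i := by
  refine le_weight_of_mem_newtonPolyhedron (fun i => (hw i).le) (fun α hα => ?_) hx
  obtain ⟨β, hβ, hmin⟩ := f.support.exists_min_image (fun α => ∑ i, w i * (α i : ℝ)) ⟨α, hα⟩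
  have h := hb _ (mem_newtonBoundary_of_minimizes hw (expR_mem_newtonPolyhedron hβ)
    fun y hy => le_weight_of_mem_newtonPolyhedron (fun i => (hw i).le) hmin hy)
  exact h.symm.trans_le (hmin α hα)

/-- If `f` is convenient, non-degenerate at `0`, and its Newton polyhedron is flat
(the affine span of the Newton boundary `Γ_f` is a hyperplane `{x | v·x = c}`),
then `f' := Σ_{α ∈ Γ_f} a_α x^α` is quasi-homogeneous, has the same Newton
polyhedron and Newton boundary as `f`, is convenient, and is non-degenerate
at `0`. -/
theorem stmt10 (n : ℕ) (hn : 2 ≤ n) (f : MvPolynomial (Fin n) ℂ)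
    (hfnc : ¬ ∃ c : ℂ, f = C c) (hf0 : eval (0 : Fin n → ℂ) f = 0)
    (hconv : Convenient f) (hnd : NondegAtZero f)
    (hflat : ∃ (v : Fin n → ℝ) (c : ℝ), v ≠ 0 ∧
      (affineSpan ℝ (NewtonBoundary f) : Set (Fin n → ℝ)) =
        {x | ∑ i, v i * x i = c}) :
    (∃ (C₀ : ℕ) (v : Fin n → ℕ), 0 < C₀ ∧ (∀ i, 0 < v i) ∧
      ∀ α ∈ (faceRestrict f (NewtonBoundary f)).support, ∑ i, v i * α i = C₀) ∧
    NewtonPolyhedron (faceRestrict f (NewtonBoundary f)) = NewtonPolyhedron f ∧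
    NewtonBoundary (faceRestrict f (NewtonBoundary f)) = NewtonBoundary f ∧
    Convenient (faceRestrict f (NewtonBoundary f)) ∧
    NondegAtZero (faceRestrict f (NewtonBoundary f)) := by
  classical
  obtain ⟨v, c, hv, hspan⟩ := hflat
  have hbv : ∀ x ∈ NewtonBoundary f, ∑ i, v i * x i = c := fun x hx => by
    have h : x ∈ (affineSpan ℝ (NewtonBoundary f) : Set (Fin n → ℝ)) :=
      subset_affineSpan ℝ _ hx
    rwa [hspan] at h
  have hex : ∀ i, ∃ m, 0 < m ∧ Finsupp.single i m ∈ f.support ∧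
      ∀ k, Finsupp.single i k ∈ f.support → m ≤ k := fun i => by
    have h := hconv.exists_single_mem_support i
    refine ⟨Nat.find h, Nat.pos_of_ne_zero fun h0 => ?_, Nat.find_spec h,
      fun k hk => Nat.find_min' h hk⟩
    have h1 := Nat.find_spec h
    rw [h0, Finsupp.single_zero, mem_support_iff] at h1
    exact h1 (by rwa [← constantCoeff_eq, ← eval_zero'])
  choose m hm0 hm hmin using hex
  have hm0' : ∀ i, (0 : ℝ) < m i := fun i => by exact_mod_cast hm0 i
  have hmb : ∀ i, expR (Finsupp.single i (m i)) ∈ NewtonBoundary f := fun i =>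
    expR_single_mem_newtonBoundary (hm0 i) (hm i) (hmin i)
  have hvm : ∀ i, v i * m i = c := fun i => by
    have h := hbv _ (hmb i)
    rw [expR_single, Finset.sum_eq_single i] at h <;> simp_all
  have hc : c ≠ 0 := fun hc => hv <| funext fun i =>
    (mul_eq_zero.1 ((hvm i).trans hc)).resolve_right (hm0' i).ne'
  have hb : ∀ x ∈ NewtonBoundary f, ∑ i, (m i : ℝ)⁻¹ * x i = 1 := fun x hx => by
    have h : ∀ i, (m i : ℝ)⁻¹ = v i / c := fun i => by
      have := (hm0' i).ne'
      rw [← hvm i] at hc ⊢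
      have := left_ne_zero_of_mul hc
      field_simp
    simp only [h, div_mul_eq_mul_div]
    rw [← Finset.sum_div, hbv x hx, div_self hc]
  have hm' : ∀ i, Finsupp.single i (m i) ∈ (faceRestrict f (NewtonBoundary f)).support :=
    fun i => mem_support_faceRestrict.2 ⟨hm i, hmb i⟩
  have hP : NewtonPolyhedron (faceRestrict f (NewtonBoundary f)) = NewtonPolyhedron f := by
    refine (newtonRegion_mono fun α hα => (mem_support_faceRestrict.1 hα).1).antisymm
      fun x hx => ?_
    exact mem_newtonPolyhedron_of_one_le hm0 hm' (nonneg_of_mem_newtonPolyhedron hx)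
      (one_le_weight_of_newtonBoundary (fun i => inv_pos.2 (hm0' i)) hb hx)
  refine ⟨⟨∏ i, m i, fun i => ∏ j ∈ Finset.univ.erase i, m j,
    Finset.prod_pos fun i _ => hm0 i, fun i => Finset.prod_pos fun j _ => hm0 j,
    fun α hα => ?_⟩, hP, ?_, ?_, ?_⟩
  · have h := hb _ (mem_support_faceRestrict.1 hα).2
    have hprod : ∀ i, ((∏ j ∈ Finset.univ.erase i, m j : ℕ) : ℝ) =
        ((∏ j, m j : ℕ) : ℝ) * (m i : ℝ)⁻¹ := fun i => by
      rw [← Finset.mul_prod_erase Finset.univ m (Finset.mem_univ i)]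
      have := (hm0' i).ne'
      push_cast
      field_simp
    have hR : (∑ i, ((∏ j ∈ Finset.univ.erase i, m j : ℕ) : ℝ) * (α i : ℝ)) =
        ((∏ j, m j : ℕ) : ℝ) := by
      simp only [hprod, mul_assoc]
      rw [← Finset.mul_sum]
      exact (congrArg _ h).trans (mul_one _)
    exact_mod_cast hR
  · rw [NewtonBoundary, hP, ← NewtonBoundary]
  · rwa [Convenient, hP]
  · intro F hF hexp hbd
    rw [hP] at hexp
    have hsub : F ⊆ NewtonBoundary f := fun x hx => ⟨F, hF, hexp, hbd, hx⟩
    rw [faceRestrict_faceRestrict_of_subset f hsub]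
    exact hnd F hF hexp hbd
end
end
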